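/- arXiv:2603.25094 — 3 statements merged into one kernel-verified Lean document; each statement's English description precedes it below -/
import Mathlib

section
/- Let n ≥ 2 be an integer and let C_sec > 0. There exists a constant C > 0, depending only on n and C_sec, with the following property. Let d, r > 0 satisfy 2d ≤ C_sec·r ≤ 1/2, let x₀ ∈ ℝⁿ, and let D ⊆ closedBall(x₀, d) be a measurable set. Then, with R := B(x₀, C_sec·r) and B := closedBall(x₀, d), every continuously differentiable u : ℝⁿ → ℝ satisfies ∫_D u² dx ≤ C·( dⁿ r^{−n} ∫_{R∖B} u² dx + d²·ζ_d ∫_R ‖∇u‖² dx ). -/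
open MeasureTheory Metric Set

theorem sq_intervalIntegral_le_mul {a b : ℝ} (hab : a < b) {f w : ℝ → ℝ}
    (hf : ContinuousOn f (Icc a b)) (hw : ContinuousOn w (Icc a b))
    (hpos : ∀ s ∈ Icc a b, 0 < w s) :
    (∫ s in a..b, f s) ^ 2 ≤ (∫ s in a..b, w s) * ∫ s in a..b, f s ^ 2 / w s := by
  set I := ∫ s in a..b, f s
  set K := ∫ s in a..b, w s with hK
  rw [← uIcc_of_le hab.le] at hf hw hpos
  have hKpos : 0 < K :=
    intervalIntegral.intervalIntegral_pos_of_pos_on hw.intervalIntegrable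
      (fun s hs => hpos s (by rw [uIcc_of_le hab.le]; exact Ioo_subset_Icc_self hs)) hab
  have hfw : ContinuousOn (fun s => f s ^ 2 / w s) (uIcc a b) :=
    (hf.pow 2).div hw fun s hs => (hpos s hs).ne'
  have h0 : 0 ≤ ∫ s in a..b, (f s ^ 2 / w s - (2 * (I / K)) * f s + (I / K) ^ 2 * w s) := by
    refine intervalIntegral.integral_nonneg hab.le fun s hs => ?_
    have hs' := hpos s (by rwa [uIcc_of_le hab.le])
    have : f s ^ 2 / w s - (2 * (I / K)) * f s + (I / K) ^ 2 * w s
        = (f s - I / K * w s) ^ 2 / w s := by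
      have := hs'.ne'
      field_simp
      ring
    rw [this]
    positivity
  rw [intervalIntegral.integral_add, intervalIntegral.integral_sub,
    intervalIntegral.integral_const_mul, intervalIntegral.integral_const_mul, ← hK] at h0
  · change 0 ≤ (∫ s in a..b, f s ^ 2 / w s) - 2 * (I / K) * I + (I / K) ^ 2 * K at h0
    have h1 : 2 * (I / K) * I - (I / K) ^ 2 * K = I ^ 2 / K := by
      field_simp
      ring
    have h2 : I ^ 2 / K ≤ ∫ s in a..b, f s ^ 2 / w s := by linarith
    rwa [div_le_iff₀' hKpos] at h2
  · exact hfw.intervalIntegrable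
  · exact (hf.const_mul _).intervalIntegrable
  · exact (hfw.sub (hf.const_mul _)).intervalIntegrable
  · exact (hw.const_mul _).intervalIntegrable

theorem sq_le_two_mul_sq_dilation_add {E : Type*} [NormedAddCommGroup E] [NormedSpace ℝ E]
    {u : E → ℝ} (hu : ContDiff ℝ 1 u) (m : ℕ) {l : ℝ} (hl : 1 < l) (x : E) :
    u x ^ 2 ≤ 2 * u (l • x) ^ 2 + 2 * (∫ s in (1 : ℝ)..l, (s ^ m)⁻¹) *
      ∫ s in (1 : ℝ)..l, s ^ m * ‖x‖ ^ 2 * ‖fderiv ℝ u (s • x)‖ ^ 2 := by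
  have hcont : Continuous fun s : ℝ => fderiv ℝ u (s • x) :=
    (hu.continuous_fderiv one_ne_zero).comp (by fun_prop)
  have hcont' : Continuous fun s : ℝ => fderiv ℝ u (s • x) x := hcont.clm_apply continuous_const
  have hFTC : ∫ s in (1 : ℝ)..l, fderiv ℝ u (s • x) x = u (l • x) - u x := by
    have := intervalIntegral.integral_eq_sub_of_hasDerivAt (a := 1) (b := l)
      (f := fun s : ℝ => u (s • x)) (f' := fun s => fderiv ℝ u (s • x) x)
      (fun s _ => by
        have h1 := (hu.differentiable one_ne_zero (s • x)).hasFDerivAt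
        have h2 : HasDerivAt (fun s : ℝ => s • x) x s := by
          simpa using (hasDerivAt_id s).smul_const x
        exact h1.comp_hasDerivAt s h2)
      (hcont'.intervalIntegrable _ _)
    simpa using this
  have hpos : ∀ s ∈ Icc 1 l, 0 < (s ^ m)⁻¹ := fun s hs => by
    have : 0 < s := by linarith [hs.1]
    positivity
  have hw : ContinuousOn (fun s : ℝ => (s ^ m)⁻¹) (Icc 1 l) :=
    ContinuousOn.inv₀ (by fun_prop) fun s hs => (inv_pos.1 (hpos s hs)).ne'
  have hCS := sq_intervalIntegral_le_mul hl hcont'.continuousOn hw hpos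
  have hmono : ∫ s in (1 : ℝ)..l, fderiv ℝ u (s • x) x ^ 2 / (s ^ m)⁻¹ ≤
      ∫ s in (1 : ℝ)..l, s ^ m * ‖x‖ ^ 2 * ‖fderiv ℝ u (s • x)‖ ^ 2 := by
    refine intervalIntegral.integral_mono_on hl.le ?_ ?_ fun s hs => ?_
    · simp only [div_inv_eq_mul]
      exact Continuous.intervalIntegrable (by fun_prop) _ _
    · exact Continuous.intervalIntegrable (by fun_prop) _ _
    · have h1 : fderiv ℝ u (s • x) x ^ 2 ≤ (‖fderiv ℝ u (s • x)‖ * ‖x‖) ^ 2 := by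
        rw [← sq_abs]
        gcongr
        exact (fderiv ℝ u (s • x)).le_opNorm x
      have h2 : 0 < s ^ m := inv_pos.1 (hpos s hs)
      rw [div_inv_eq_mul]
      nlinarith
  have hK : 0 ≤ ∫ s in (1 : ℝ)..l, (s ^ m)⁻¹ :=
    intervalIntegral.integral_nonneg hl.le fun s hs => (hpos s hs).le
  have := hCS.trans (mul_le_mul_of_nonneg_left hmono hK)
  rw [hFTC] at this
  nlinarith [sq_nonneg (u (l • x) + (u (l • x) - u x))]

theorem intervalIntegral_inv_pow_le {m : ℕ} (hm : 2 ≤ m) {l : ℝ} (hl : 1 ≤ l) :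
    ∫ s in (1 : ℝ)..l, (s ^ m)⁻¹ ≤ 1 := by
  have hne : ∀ s ∈ Icc 1 l, s ≠ 0 := fun s hs => by linarith [hs.1]
  have hint (k : ℕ) : IntervalIntegrable (fun s : ℝ => (s ^ k)⁻¹) volume 1 l :=
    ContinuousOn.intervalIntegrable_of_Icc hl
      (ContinuousOn.inv₀ (by fun_prop) fun s hs => pow_ne_zero _ (hne s hs))
  calc ∫ s in (1 : ℝ)..l, (s ^ m)⁻¹ ≤ ∫ s in (1 : ℝ)..l, (s ^ 2)⁻¹ := by
        refine intervalIntegral.integral_mono_on hl (hint m) (hint 2) fun s hs => ?_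
        have : 0 < s := by linarith [hs.1]
        gcongr
        exact hs.1
    _ = -l⁻¹ - -1⁻¹ := by
        refine intervalIntegral.integral_eq_sub_of_hasDerivAt (f := fun s => -s⁻¹)
          (fun s hs => ?_) (hint 2)
        rw [uIcc_of_le hl] at hs
        simpa [neg_div] using (hasDerivAt_inv (hne s hs)).fun_neg
    _ ≤ 1 := by
        have : 0 < l⁻¹ := by positivity
        simp [this.le]

theorem lintegral_inv_cube_indicator_le {a l : ℝ} (ha : 0 < a) :
    ∫⁻ s in Ioc 1 l, (Ici a).indicator (fun s => ENNReal.ofReal (s ^ 3)⁻¹) s ≤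
      ENNReal.ofReal ((a ^ 2)⁻¹ / 2) := by
  have hI : ∫⁻ s in Ioi a, ENNReal.ofReal (s ^ 3)⁻¹ = ENNReal.ofReal ((a ^ 2)⁻¹ / 2) := by
    have hEq : EqOn (fun s : ℝ => (s ^ 3)⁻¹) (fun s => s ^ (-3 : ℝ)) (Ioi a) := fun s hs => by
      have : 0 < s := ha.trans hs
      simp only
      rw [Real.rpow_neg this.le]
      norm_cast
    rw [← ofReal_integral_eq_lintegral_ofReal]
    · rw [setIntegral_congr_fun measurableSet_Ioi hEq, integral_Ioi_rpow_of_lt (by norm_num) ha]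
      congr 1
      norm_num
    · exact (integrableOn_congr_fun hEq measurableSet_Ioi).2
        (integrableOn_Ioi_rpow_of_lt (by norm_num) ha)
    · filter_upwards [ae_restrict_mem measurableSet_Ioi] with s hs
      have : 0 < s := ha.trans hs
      positivity
  calc _ ≤ ∫⁻ s, (Ici a).indicator (fun s => ENNReal.ofReal (s ^ 3)⁻¹) s :=
        setLIntegral_le_lintegral _ _
    _ = ∫⁻ s in Ioi a, ENNReal.ofReal (s ^ 3)⁻¹ := by
        rw [lintegral_indicator measurableSet_Ici, setLIntegral_congr Ioi_ae_eq_Ici.symm]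
    _ = _ := hI

section Haar

variable {E : Type*} [NormedAddCommGroup E] [NormedSpace ℝ E] [FiniteDimensional ℝ E]
  [MeasurableSpace E] [BorelSpace E] (μ : Measure E) [μ.IsAddHaarMeasure]

theorem setLIntegral_closedBall_comp_smul {g : E → ENNReal} (hg : Measurable g) (d : ℝ)
    {s : ℝ} (hs : 0 < s) :
    ∫⁻ x in closedBall 0 d, g (s • x) ∂μ =
      ENNReal.ofReal (s ^ Module.finrank ℝ E)⁻¹ * ∫⁻ y in closedBall 0 (s * d), g y ∂μ := by
  have hpre : (s • · : E → E) ⁻¹' closedBall 0 (s * d) = closedBall 0 d := by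
    ext x
    simp [norm_smul, abs_of_pos hs, hs]
  rw [← hpre, ← setLIntegral_map measurableSet_closedBall hg (measurable_const_smul s),
    Measure.map_addHaar_smul μ hs.ne', Measure.restrict_smul, lintegral_smul_measure,
    abs_of_pos (by positivity), smul_eq_mul]

theorem lintegral_radial_dilation_le {m : ℕ} (hE : Module.finrank ℝ E = m + 1)
    {q : E → ENNReal} (hq : Measurable q) {d l : ℝ} (hd : 0 < d) :
    ∫⁻ x in closedBall 0 d, (∫⁻ s in Ioc 1 l,
        ENNReal.ofReal (s ^ m * ‖x‖ ^ 2) * q (s • x)) ∂μ ≤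
      ENNReal.ofReal (d ^ 2 / 2) * ∫⁻ y in closedBall 0 (l * d), q y ∂μ := by
  set g : E → ENNReal := fun y => ENNReal.ofReal (‖y‖ ^ 2) * q y with hg
  have hgm : Measurable g := by fun_prop
  set S : Set (E × ℝ) := {p | ‖p.1‖ ≤ p.2 * d} with hS
  have hSm : MeasurableSet S :=
    (isClosed_le (by fun_prop) (by fun_prop)).measurableSet
  set H : E × ℝ → ENNReal := S.indicator fun p => ENNReal.ofReal (p.2 ^ 3)⁻¹ * g p.1 with hH
  have hHm : Measurable H := Measurable.indicator (by fun_prop) hSm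
  have hdil : ∀ s ∈ Ioc 1 l, ∫⁻ x in closedBall 0 d,
      ENNReal.ofReal (s ^ m * ‖x‖ ^ 2) * q (s • x) ∂μ = ∫⁻ y, H (y, s) ∂μ := fun s hs => by
    have hs0 : 0 < s := by linarith [hs.1]
    have h1 (x : E) : ENNReal.ofReal (s ^ m * ‖x‖ ^ 2) * q (s • x) =
        ENNReal.ofReal (s ^ m / s ^ 2) * g (s • x) := by
      rw [hg, ← mul_assoc, ← ENNReal.ofReal_mul (by positivity), norm_smul, Real.norm_eq_abs,
        abs_of_pos hs0]
      congr 2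
      field_simp
    have h2 : (fun y => H (y, s)) = (closedBall (0 : E) (s * d)).indicator
        fun y => ENNReal.ofReal (s ^ 3)⁻¹ * g y := by
      ext y
      simp [hH, hS, indicator]
    simp_rw [h1]
    rw [h2, lintegral_indicator measurableSet_closedBall, lintegral_const_mul _ (by fun_prop),
      lintegral_const_mul _ hgm, setLIntegral_closedBall_comp_smul μ hgm d hs0, ← mul_assoc,
      ← ENNReal.ofReal_mul (by positivity), hE]
    congr 2
    field_simp
    ring
  have hpt (y : E) : ∫⁻ s in Ioc 1 l, H (y, s) ≤
      (closedBall (0 : E) (l * d)).indicator (fun y => ENNReal.ofReal (d ^ 2 / 2) * q y) y := by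
    by_cases hy : y ∈ closedBall (0 : E) (l * d)
    · rw [indicator_of_mem hy]
      rcases eq_or_ne y 0 with rfl | hy0
      · simp [hH, hg, indicator]
      have hny : 0 < ‖y‖ := norm_pos_iff.2 hy0
      have hfac (s : ℝ) : H (y, s) =
          (Ici (‖y‖ / d)).indicator (fun s => ENNReal.ofReal (s ^ 3)⁻¹) s * g y := by
        simp only [hH, hS, indicator, mem_ofPred_eq, mem_Ici, div_le_iff₀ hd]
        split_ifs <;> simp
      simp_rw [hfac]
      rw [lintegral_mul_const _ (Measurable.indicator (by fun_prop) measurableSet_Ici)]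
      refine (mul_le_mul_left (lintegral_inv_cube_indicator_le (by positivity)) _).trans
        (le_of_eq ?_)
      rw [hg, ← mul_assoc, ← ENNReal.ofReal_mul (by positivity)]
      congr 2
      field_simp
    · rw [indicator_of_notMem hy]
      refine (setLIntegral_congr_fun (g := 0) measurableSet_Ioc fun s hs => ?_).trans_le (by simp)
      refine indicator_of_notMem (fun h => hy ?_) _
      have h' : ‖y‖ ≤ s * d := h
      rw [mem_closedBall_zero_iff]
      nlinarith [hs.2]
  calc _ = ∫⁻ s in Ioc 1 l, ∫⁻ x in closedBall 0 d,
        ENNReal.ofReal (s ^ m * ‖x‖ ^ 2) * q (s • x) ∂μ :=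
        lintegral_lintegral_swap (by
          refine Measurable.aemeasurable ?_
          simp only [Function.uncurry_def]
          have : Measurable fun p : E × ℝ => q (p.2 • p.1) := hq.comp (by fun_prop)
          fun_prop)
    _ = ∫⁻ s in Ioc 1 l, ∫⁻ y, H (y, s) ∂μ := setLIntegral_congr_fun measurableSet_Ioc hdil
    _ = ∫⁻ y, (∫⁻ s in Ioc 1 l, H (y, s)) ∂μ :=
        (lintegral_lintegral_swap (f := fun y s => H (y, s)) hHm.aemeasurable).symm
    _ ≤ ∫⁻ y, (closedBall (0 : E) (l * d)).indicator
          (fun y => ENNReal.ofReal (d ^ 2 / 2) * q y) y ∂μ := lintegral_mono hpt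
    _ = _ := by
        rw [lintegral_indicator measurableSet_closedBall, lintegral_const_mul _ hq]

theorem integral_radial_dilation_le {m : ℕ} (hE : Module.finrank ℝ E = m + 1)
    {p : E → ℝ} (hp : Continuous p) (hp0 : ∀ x, 0 ≤ p x) {d l : ℝ} (hd : 0 < d) (hl : 1 ≤ l) :
    ∫ x in closedBall 0 d, (∫ s in (1 : ℝ)..l, s ^ m * ‖x‖ ^ 2 * p (s • x)) ∂μ ≤
      d ^ 2 / 2 * ∫ y in closedBall 0 (l * d), p y ∂μ := by
  have hnn (x : E) : ∀ s ∈ Ioc 1 l, 0 ≤ s ^ m * ‖x‖ ^ 2 * p (s • x) := fun s hs => by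
    have : 0 < s := by linarith [hs.1]
    have := hp0 (s • x)
    positivity
  have hinner (x : E) : ENNReal.ofReal (∫ s in (1 : ℝ)..l, s ^ m * ‖x‖ ^ 2 * p (s • x)) =
      ∫⁻ s in Ioc 1 l, ENNReal.ofReal (s ^ m * ‖x‖ ^ 2) * ENNReal.ofReal (p (s • x)) := by
    rw [intervalIntegral.integral_of_le hl, ofReal_integral_eq_lintegral_ofReal]
    · simp_rw [ENNReal.ofReal_mul' (hp0 _)]
    · exact (Continuous.integrableOn_Icc (by fun_prop)).mono_set Ioc_subset_Icc_self
    · exact (ae_restrict_mem measurableSet_Ioc).mono (hnn x)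
  have hcont : Continuous fun x : E => ∫ s in (1 : ℝ)..l, s ^ m * ‖x‖ ^ 2 * p (s • x) :=
    intervalIntegral.continuous_parametric_intervalIntegral_of_continuous' (by fun_prop) _ _
  have hint0 : 0 ≤ ∫ y in closedBall 0 (l * d), p y ∂μ := integral_nonneg hp0
  rw [← ENNReal.ofReal_le_ofReal_iff (by positivity), ofReal_integral_eq_lintegral_ofReal,
    ENNReal.ofReal_mul (by positivity), ofReal_integral_eq_lintegral_ofReal]
  · simp_rw [hinner]
    exact lintegral_radial_dilation_le μ hE (ENNReal.measurable_ofReal.comp hp.measurable) hd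
  · exact hp.continuousOn.integrableOn_compact (isCompact_closedBall _ _)
  · exact ae_of_all _ hp0
  · exact hcont.continuousOn.integrableOn_compact (isCompact_closedBall _ _)
  · refine ae_of_all _ fun x => ?_
    simp only [Pi.zero_apply, intervalIntegral.integral_of_le hl]
    exact setIntegral_nonneg measurableSet_Ioc (hnn x)

/-- Estimate of `u` on a small ball by its values on the surrounding shell and its gradient,
obtained by comparing `u` with its dilation `u (l • ·)`. -/
theorem setIntegral_sq_closedBall_le {m : ℕ} (hm : 1 ≤ m) (hE : Module.finrank ℝ E = m + 1)
    {u : E → ℝ} (hu : ContDiff ℝ 1 u) {d l : ℝ} (hd : 0 < d) (hl : 2 ≤ l) :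
    ∫ x in closedBall 0 d, u x ^ 2 ∂μ ≤
      4 * ((l ^ (m + 1))⁻¹ * ∫ x in closedBall 0 (l * d) \ closedBall 0 d, u x ^ 2 ∂μ) +
      2 * (d ^ 2 * (∫ s in (1 : ℝ)..l, (s ^ m)⁻¹) *
        ∫ x in closedBall 0 (l * d), ‖fderiv ℝ u x‖ ^ 2 ∂μ) := by
  have hl0 : 0 < l := by linarith
  have hfd := hu.continuous_fderiv one_ne_zero
  have huc := hu.continuous
  have hint {f : E → ℝ} (hf : Continuous f) (R : ℝ) : IntegrableOn f (closedBall 0 R) μ :=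
    hf.continuousOn.integrableOn_compact (isCompact_closedBall _ _)
  have hsub : closedBall (0 : E) d ⊆ closedBall 0 (l * d) := closedBall_subset_closedBall (by
    nlinarith)
  set K := ∫ s in (1 : ℝ)..l, (s ^ m)⁻¹
  have hK : 0 ≤ K := intervalIntegral.integral_nonneg (by linarith) fun s hs => by
    have : 0 ≤ s := by linarith [hs.1]
    positivity
  have hcont : Continuous fun x : E =>
      ∫ s in (1 : ℝ)..l, s ^ m * ‖x‖ ^ 2 * ‖fderiv ℝ u (s • x)‖ ^ 2 :=
    intervalIntegral.continuous_parametric_intervalIntegral_of_continuous' (by fun_prop) _ _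
  have h1 : ∫ x in closedBall 0 d, u x ^ 2 ∂μ ≤ ∫ x in closedBall 0 d, (2 * u (l • x) ^ 2 +
      2 * K * ∫ s in (1 : ℝ)..l, s ^ m * ‖x‖ ^ 2 * ‖fderiv ℝ u (s • x)‖ ^ 2) ∂μ :=
    setIntegral_mono (hint (by fun_prop) d) (hint (by fun_prop) d) fun x =>
      sq_le_two_mul_sq_dilation_add hu m (by linarith) x
  rw [integral_add (hint (by fun_prop) d) (hint (by fun_prop) d), integral_const_mul,
    integral_const_mul,
    Measure.setIntegral_comp_smul_of_pos μ (fun x => u x ^ 2) _ hl0, smul_closedBall _ _ hd.le,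
    smul_zero, Real.norm_of_nonneg hl0.le, hE, smul_eq_mul] at h1
  have h2 := mul_le_mul_of_nonneg_left (integral_radial_dilation_le μ hE
    (p := fun x => ‖fderiv ℝ u x‖ ^ 2) (by fun_prop) (fun x => by positivity) hd
    (by linarith : 1 ≤ l)) (by positivity : 0 ≤ 2 * K)
  have h3 := setIntegral_union (μ := μ) (f := fun x => u x ^ 2) (disjoint_sdiff_right
    (s := closedBall (0 : E) d) (t := closedBall 0 (l * d)))
    (measurableSet_closedBall.diff measurableSet_closedBall) (hint (by fun_prop) d)
    ((hint (by fun_prop) (l * d)).mono_set sdiff_subset)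
  rw [union_sdiff_cancel hsub] at h3
  have h4 : (l ^ (m + 1))⁻¹ ≤ 1 / 4 := by
    rw [one_div]
    gcongr
    calc (4 : ℝ) = 2 ^ 2 := by norm_num
      _ ≤ l ^ 2 := by gcongr
      _ ≤ l ^ (m + 1) := pow_le_pow_right₀ (by linarith) (by omega)
  have h5 : 0 ≤ ∫ x in closedBall 0 d, u x ^ 2 ∂μ := integral_nonneg fun x => sq_nonneg _
  have h6 := mul_le_mul_of_nonneg_right h4 h5
  rw [h3] at h1
  linarith

end Haar

theorem intervalIntegral_inv_pow_le_capacity {n : ℕ} (hn : 2 ≤ n) {d l : ℝ} (hd : 0 < d)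
    (hl : 1 ≤ l) (hld : l * d ≤ 1) :
    ∫ s in (1 : ℝ)..l, (s ^ (n - 1))⁻¹ ≤ if n = 2 then |Real.log d| else 1 := by
  split_ifs with h
  · subst h
    have : ∫ s in (1 : ℝ)..l, (s ^ (2 - 1))⁻¹ = Real.log l := by
      simpa using integral_inv_of_pos one_pos (by linarith : 0 < l)
    rw [this]
    have h1 : Real.log (l * d) ≤ 0 := Real.log_nonpos (by positivity) hld
    rw [Real.log_mul (by positivity) hd.ne'] at h1
    linarith [neg_le_abs (Real.log d)]
  · exact intervalIntegral_inv_pow_le (by omega) hl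

/-- Lemma 3.3 of the paper (volume estimate on the hole): for `n ≥ 2` and `C_sec > 0` there
is `C > 0` depending only on `n` and `C_sec` such that, whenever `0 < 2d ≤ C_sec r ≤ 1/2`
and `D ⊆ closedBall(x₀,d)` is measurable, every `C¹` function `u` satisfies, with
`R = B(x₀, C_sec r)` and `B = closedBall(x₀,d)`,
`∫_D u² ≤ C (dⁿ r^{-n} ∫_{R∖B} u² + d² ζ_d ∫_R ‖∇u‖²)`. -/
theorem hole_volume_estimate (n : ℕ) (hn : 2 ≤ n) (Csec : ℝ) (hCsec : 0 < Csec) :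
    ∃ C > (0 : ℝ), ∀ (d r : ℝ) (x₀ : EuclideanSpace ℝ (Fin n))
      (D : Set (EuclideanSpace ℝ (Fin n))),
      0 < d → 0 < r → 2 * d ≤ Csec * r → Csec * r ≤ 1 / 2 →
      MeasurableSet D → D ⊆ closedBall x₀ d →
      ∀ u : EuclideanSpace ℝ (Fin n) → ℝ, ContDiff ℝ 1 u →
        (∫ x in D, (u x) ^ 2) ≤
          C * (d ^ n / r ^ n
                * (∫ x in ball x₀ (Csec * r) \ closedBall x₀ d, (u x) ^ 2)
            + d ^ 2 * (if n = 2 then |Real.log d| else 1)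
                * (∫ x in ball x₀ (Csec * r), ‖gradient u x‖ ^ 2)) := by
  obtain ⟨m, rfl⟩ : ∃ m, n = m + 1 := ⟨n - 1, by omega⟩
  have hfin : Module.finrank ℝ (EuclideanSpace ℝ (Fin (m + 1))) = m + 1 := by simp
  have : Nontrivial (EuclideanSpace ℝ (Fin (m + 1))) := Module.nontrivial_of_finrank_pos (R := ℝ)
    (by omega)
  refine ⟨4 * (Csec ^ (m + 1))⁻¹ + 2, by positivity, ?_⟩
  intro d r x₀ D hd hr hdr hr2 _ hDB u hu
  set l := Csec * r / d with hl
  have hld : l * d = Csec * r := by rw [hl]; field_simp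
  have hl2 : 2 ≤ l := by rw [hl, le_div_iff₀ hd]; exact hdr
  have huc := hu.continuous
  set v := fun x => u (x₀ + x) with hv
  have htr (f : EuclideanSpace ℝ (Fin (m + 1)) → ℝ) (s : Set (EuclideanSpace ℝ (Fin (m + 1)))) :
      ∫ x in (x₀ + ·) ⁻¹' s, f (x₀ + x) = ∫ x in s, f x :=
    (measurePreserving_add_left volume x₀).setIntegral_preimage_emb
      (measurableEmbedding_addLeft x₀) f s
  have hball (R : ℝ) : closedBall 0 R = (x₀ + ·) ⁻¹' closedBall x₀ R := by
    simp [preimage_add_closedBall]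
  have hmain := setIntegral_sq_closedBall_le volume (by omega) hfin (u := v)
    (hu.comp (contDiff_const.add contDiff_id)) hd hl2
  have hfv (x : EuclideanSpace ℝ (Fin (m + 1))) :
      ‖fderiv ℝ v x‖ ^ 2 = ‖gradient u (x₀ + x)‖ ^ 2 := by
    rw [hv, fderiv_comp_add_left, gradient, LinearIsometryEquiv.norm_map]
  rw [funext hfv] at hmain
  have hae : closedBall x₀ (Csec * r) =ᵐ[volume] ball x₀ (Csec * r) := by
    rw [← ball_union_sphere]
    exact union_ae_eq_left_of_ae_eq_empty
      (ae_eq_empty.2 (Measure.addHaar_sphere volume x₀ (Csec * r)))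
  have haeD : (closedBall x₀ (Csec * r) \ closedBall x₀ d : Set _) =ᵐ[volume]
      (ball x₀ (Csec * r) \ closedBall x₀ d : Set _) := ae_eq_set_sdiff hae (ae_eq_refl _)
  rw [hball, hball, ← preimage_sdiff, htr (fun x => u x ^ 2), htr (fun x => u x ^ 2),
    htr (fun x => ‖gradient u x‖ ^ 2), hld, setIntegral_congr_set haeD,
    setIntegral_congr_set hae] at hmain
  have hD : ∫ x in D, u x ^ 2 ≤ ∫ x in closedBall x₀ d, u x ^ 2 :=
    setIntegral_mono_set ((by fun_prop : Continuous fun x => u x ^ 2).continuousOn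
      |>.integrableOn_compact (isCompact_closedBall _ _)) (ae_of_all _ fun x => sq_nonneg _)
      hDB.eventuallyLE
  have hcap := intervalIntegral_inv_pow_le_capacity (l := l) hn hd (by linarith) (by linarith)
  rw [Nat.add_sub_cancel] at hcap
  set ζ : ℝ := if m + 1 = 2 then |Real.log d| else 1 with hζ
  have hζ0 : 0 ≤ ζ := by rw [hζ]; split_ifs <;> positivity
  set A := ∫ x in ball x₀ (Csec * r) \ closedBall x₀ d, u x ^ 2
  set G := ∫ x in ball x₀ (Csec * r), ‖gradient u x‖ ^ 2
  have hA : 0 ≤ A := integral_nonneg fun x => sq_nonneg _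
  have hG : 0 ≤ G := integral_nonneg fun x => sq_nonneg _
  have hlp : (l ^ (m + 1))⁻¹ * A = (Csec ^ (m + 1))⁻¹ * (d ^ (m + 1) / r ^ (m + 1) * A) := by
    rw [hl, div_pow, mul_pow]
    field_simp
  have hEG : d ^ 2 * (∫ s in (1 : ℝ)..l, (s ^ m)⁻¹) * G ≤ d ^ 2 * ζ * G := by gcongr
  rw [hlp] at hmain
  have hX : 0 ≤ d ^ (m + 1) / r ^ (m + 1) * A := by positivity
  have hY : 0 ≤ (Csec ^ (m + 1))⁻¹ * (d ^ 2 * ζ * G) := by positivity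
  linarith
end

section
/- Let n ≥ 2 be an integer and let C̃, C_sec, C_inn, C_R > 0. There exists a constant C > 0, depending only on n, C̃, C_sec, C_inn and C_R, with the following property. Let d, r > 0 satisfy 2d ≤ C_sec·r ≤ 1/2. Let Γ ⊂ ℝⁿ be a bounded convex open set such that B(x₀, C_sec·r) ⊆ Γ for some x₀ ∈ ℝⁿ and diam Γ ≤ C̃·r. Let D be an open set with closedBall(z, C_inn·d) ⊆ D ⊆ closedBall(x₀, d) for some z ∈ ℝⁿ, such that every continuously differentiable v : ℝⁿ → ℝ satisfies ∫_D v² dx ≤ C_R·( d ∫_{∂D} v² dH^{n−1} + d² ∫_D ‖∇v‖² dx ). Then every continuously differentiable u : ℝⁿ → ℝ satisfies ∫_Γ u² dx ≤ C·( rⁿ d^{1−n} ∫_{∂D} u² dH^{n−1} + rⁿ d^{2−n} ζ_d ∫_Γ ‖∇u‖² dx ). -/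
open MeasureTheory Metric Set

theorem sq_intervalIntegral_le {a b : ℝ} (hab : a < b) {w f : ℝ → ℝ}
    (hw : ContinuousOn w (Icc a b)) (hf : ContinuousOn f (Icc a b))
    (hpos : ∀ t ∈ Icc a b, 0 < w t) :
    (∫ t in a..b, f t) ^ 2 ≤ (∫ t in a..b, (w t)⁻¹) * ∫ t in a..b, w t * f t ^ 2 := by
  have hwi : ContinuousOn (fun t => (w t)⁻¹) (Icc a b) := hw.inv₀ fun t ht => (hpos t ht).ne'
  have i1 : IntervalIntegrable (fun t => (w t)⁻¹) volume a b :=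
    hwi.intervalIntegrable_of_Icc hab.le
  have i2 : IntervalIntegrable f volume a b := hf.intervalIntegrable_of_Icc hab.le
  have i3 : IntervalIntegrable (fun t => w t * f t ^ 2) volume a b :=
    (hw.mul (hf.pow 2)).intervalIntegrable_of_Icc hab.le
  set L := ∫ t in a..b, (w t)⁻¹
  set F := ∫ t in a..b, f t
  have hL : 0 < L := intervalIntegral.intervalIntegral_pos_of_pos_on i1
    (fun t ht => inv_pos.2 (hpos t (Ioo_subset_Icc_self ht))) hab
  have key : 0 ≤ ∫ t in a..b, (w t * f t ^ 2 - 2 * (F / L) * f t + (F / L) ^ 2 * (w t)⁻¹) := by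
    refine intervalIntegral.integral_nonneg hab.le fun t ht => ?_
    have h := hpos t ht
    have : w t * f t ^ 2 - 2 * (F / L) * f t + (F / L) ^ 2 * (w t)⁻¹
        = w t * (f t - F / L * (w t)⁻¹) ^ 2 := by
      field_simp
      ring
    rw [this]
    positivity
  rw [intervalIntegral.integral_add (i3.sub (i2.const_mul _)) (i1.const_mul _),
    intervalIntegral.integral_sub i3 (i2.const_mul _), intervalIntegral.integral_const_mul,
    intervalIntegral.integral_const_mul] at key
  change 0 ≤ (∫ t in a..b, w t * f t ^ 2) - 2 * (F / L) * F + (F / L) ^ 2 * L at key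
  have e : (∫ t in a..b, w t * f t ^ 2) - 2 * (F / L) * F + (F / L) ^ 2 * L
      = (∫ t in a..b, w t * f t ^ 2) - F ^ 2 / L := by
    field_simp
    ring
  rw [e, sub_nonneg, div_le_iff₀ hL] at key
  linarith

theorem sq_le_sq_smul_add_integral_ray {E : Type*} [NormedAddCommGroup E] [NormedSpace ℝ E]
    {v : E → ℝ} (hv : ContDiff ℝ 1 v) (k : ℕ) {a : ℝ} (ha : 0 < a) (ha1 : a < 1) (x : E) :
    v x ^ 2 ≤ 2 * v (a • x) ^ 2 + 2 * ((∫ t in a..1, (t ^ k)⁻¹) *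
      ∫ t in a..1, t ^ k * (‖fderiv ℝ v (t • x)‖ * ‖x‖) ^ 2) := by
  have hcd : Continuous (fun t : ℝ => fderiv ℝ v (t • x)) :=
    (hv.continuous_fderiv one_ne_zero).comp (by fun_prop)
  have hc : Continuous (fun t : ℝ => fderiv ℝ v (t • x) x) := hcd.clm_apply continuous_const
  have ftc : ∫ t in a..1, fderiv ℝ v (t • x) x = v x - v (a • x) := by
    rw [intervalIntegral.integral_eq_sub_of_hasDerivAt (f := fun t : ℝ => v (t • x))
      (fun t _ => ?_) (hc.intervalIntegrable _ _), one_smul]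
    have h1 : HasDerivAt (fun t : ℝ => t • x) x t := by
      simpa using (hasDerivAt_id t).smul_const x
    exact ((hv.differentiable one_ne_zero (t • x)).hasFDerivAt).comp_hasDerivAt t h1
  have cs := sq_intervalIntegral_le ha1 (w := fun t => t ^ k) (by fun_prop) hc.continuousOn
    (fun t ht => pow_pos (ha.trans_le ht.1) k)
  rw [ftc] at cs
  have hmono : ∫ t in a..1, t ^ k * (fderiv ℝ v (t • x) x) ^ 2
      ≤ ∫ t in a..1, t ^ k * (‖fderiv ℝ v (t • x)‖ * ‖x‖) ^ 2 := by
    refine intervalIntegral.integral_mono_on ha1.le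
      (Continuous.intervalIntegrable (by fun_prop) _ _)
      (Continuous.intervalIntegrable (by fun_prop) _ _) fun t ht => ?_
    have := (fderiv ℝ v (t • x)).le_opNorm x
    rw [← sq_abs, ← Real.norm_eq_abs]
    have := ha.trans_le ht.1
    gcongr
  have hL : 0 ≤ ∫ t in a..1, (t ^ k)⁻¹ := intervalIntegral.integral_nonneg ha1.le
    fun t ht => inv_nonneg.2 (pow_nonneg (ha.le.trans ht.1) k)
  have := mul_le_mul_of_nonneg_left hmono hL
  nlinarith [sq_nonneg (v x - 2 * v (a • x))]

theorem lintegral_comp_pos_smul {E : Type*} [NormedAddCommGroup E] [NormedSpace ℝ E]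
    [FiniteDimensional ℝ E] [MeasurableSpace E] [BorelSpace E] (μ : Measure E) [μ.IsAddHaarMeasure]
    (f : E → ENNReal) {t : ℝ} (ht : 0 < t) :
    ∫⁻ x, f (t • x) ∂μ = ENNReal.ofReal ((t ^ Module.finrank ℝ E)⁻¹) * ∫⁻ x, f x ∂μ := by
  have h := lintegral_map_equiv f (MeasurableEquiv.smul₀ t ht.ne') (μ := μ)
  have e : μ.map (MeasurableEquiv.smul₀ t ht.ne') =
      ENNReal.ofReal ((t ^ Module.finrank ℝ E)⁻¹) • μ := by
    have := Measure.map_addHaar_smul μ ht.ne'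
    rwa [abs_of_pos (by positivity)] at this
  rw [e, lintegral_smul_measure] at h
  exact h.symm

theorem lintegral_inv_cube_le {s R : ℝ} (hs : 0 ≤ s) (hR : 0 < R) (I : Set ℝ) :
    ∫⁻ t in I, {t : ℝ | s ≤ t * R}.indicator (fun t => ENNReal.ofReal ((t ^ 3)⁻¹ * s ^ 2)) t
      ≤ ENNReal.ofReal (R ^ 2 / 2) := by
  rcases hs.eq_or_lt with rfl | hs
  · simp
  have hc : 0 < s / R := by positivity
  have hset : {t : ℝ | s ≤ t * R} = Ici (s / R) := by
    ext t
    simp [div_le_iff₀ hR]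
  have hpow : ∀ t ∈ Ioi (s / R), (t ^ 3)⁻¹ * s ^ 2 = t ^ (-3 : ℝ) * s ^ 2 := by
    intro t ht
    rw [Real.rpow_neg (hc.trans ht).le]
    norm_cast
  have hint : IntegrableOn (fun t : ℝ => t ^ (-3 : ℝ) * s ^ 2) (Ioi (s / R)) :=
    (integrableOn_Ioi_rpow_of_lt (by norm_num) hc).mul_const _
  calc
    _ ≤ ∫⁻ t, {t : ℝ | s ≤ t * R}.indicator
          (fun t => ENNReal.ofReal ((t ^ 3)⁻¹ * s ^ 2)) t := setLIntegral_le_lintegral _ _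
    _ = ∫⁻ t in Ioi (s / R), ENNReal.ofReal ((t ^ 3)⁻¹ * s ^ 2) := by
      rw [hset, lintegral_indicator measurableSet_Ici, setLIntegral_congr Ioi_ae_eq_Ici]
    _ = ∫⁻ t in Ioi (s / R), ENNReal.ofReal (t ^ (-3 : ℝ) * s ^ 2) :=
      setLIntegral_congr_fun measurableSet_Ioi fun t ht => by simp only [hpow t ht]
    _ = ENNReal.ofReal (∫ t in Ioi (s / R), t ^ (-3 : ℝ) * s ^ 2) := by
      rw [ofReal_integral_eq_lintegral_ofReal hint]
      filter_upwards [ae_restrict_mem measurableSet_Ioi] with t ht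
      have := hc.trans ht
      positivity
    _ = ENNReal.ofReal (R ^ 2 / 2) := by
      rw [integral_mul_const, integral_Ioi_rpow_of_lt (by norm_num) hc]
      congr 1
      have : (s / R) ^ (-3 + 1 : ℝ) = ((s / R) ^ 2)⁻¹ := by
        rw [show (-3 + 1 : ℝ) = -(2 : ℝ) by norm_num, Real.rpow_neg hc.le]
        norm_cast
      rw [this]
      field_simp
      norm_num

section StarShaped

variable {E : Type*} [NormedAddCommGroup E] [NormedSpace ℝ E] [FiniteDimensional ℝ E]
  [MeasurableSpace E] [BorelSpace E] (μ : Measure E) [μ.IsAddHaarMeasure]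

theorem setLIntegral_comp_smul_le {S : Set E} (hS : MeasurableSet S) {R : ℝ}
    (hSR : S ⊆ closedBall 0 R) (hstar : ∀ x ∈ S, ∀ t : ℝ, 0 < t → t ≤ 1 → t • x ∈ S)
    (f : E → ENNReal) {t : ℝ} (ht : 0 < t) (ht1 : t ≤ 1) :
    ∫⁻ x in S, f (t • x) ∂μ ≤ ENNReal.ofReal ((t ^ Module.finrank ℝ E)⁻¹) *
      ∫⁻ x in S ∩ closedBall 0 (t * R), f x ∂μ := by
  rw [← lintegral_indicator hS, ← lintegral_indicator (hS.inter measurableSet_closedBall),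
    ← lintegral_comp_pos_smul μ _ ht]
  refine lintegral_mono fun x => ?_
  by_cases hx : x ∈ S
  swap
  · simp [indicator_of_notMem hx]
  rw [indicator_of_mem hx, indicator_of_mem]
  refine ⟨hstar x hx t ht ht1, ?_⟩
  have := hSR hx
  rw [mem_closedBall_zero_iff] at this ⊢
  rw [norm_smul, Real.norm_of_nonneg ht.le]
  gcongr

theorem setLIntegral_ray_le {S : Set E} (hS : MeasurableSet S) {R : ℝ} (hR : 0 < R)
    (hSR : S ⊆ closedBall 0 R) (hstar : ∀ x ∈ S, ∀ t : ℝ, 0 < t → t ≤ 1 → t • x ∈ S)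
    {k : ℕ} (hk : Module.finrank ℝ E = k + 1) {g : E → ℝ} (hg : Continuous g) {a : ℝ}
    (ha : 0 < a) :
    ∫⁻ x in S, (∫⁻ t in Ioc a 1, ENNReal.ofReal (t ^ k * (g (t • x) * ‖x‖) ^ 2)) ∂μ
      ≤ ENNReal.ofReal (R ^ 2 / 2) * ∫⁻ x in S, ENNReal.ofReal (g x ^ 2) ∂μ := by
  have hmeas : Measurable fun p : ℝ × E => {t : ℝ | ‖p.2‖ ≤ t * R}.indicator
      (fun t => ENNReal.ofReal ((t ^ 3)⁻¹ * ‖p.2‖ ^ 2)) p.1 * ENNReal.ofReal (g p.2 ^ 2) := by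
    have h1 : MeasurableSet {p : ℝ × E | ‖p.2‖ ≤ p.1 * R} :=
      measurableSet_le (by fun_prop) (by fun_prop)
    have h2 : Measurable fun p : ℝ × E => ENNReal.ofReal ((p.1 ^ 3)⁻¹ * ‖p.2‖ ^ 2) := by
      fun_prop
    have h3 : Measurable fun p : ℝ × E => ENNReal.ofReal (g p.2 ^ 2) := by fun_prop
    exact (h2.indicator h1).mul h3
  rw [lintegral_lintegral_swap (by fun_prop)]
  calc
    _ ≤ ∫⁻ t in Ioc a 1, (∫⁻ y in S, {t : ℝ | ‖y‖ ≤ t * R}.indicator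
          (fun t => ENNReal.ofReal ((t ^ 3)⁻¹ * ‖y‖ ^ 2)) t * ENNReal.ofReal (g y ^ 2) ∂μ) := by
      refine setLIntegral_mono' measurableSet_Ioc fun t ht => ?_
      have ht0 : 0 < t := ha.trans ht.1
      have e : ∀ x : E, ENNReal.ofReal (t ^ k * (g (t • x) * ‖x‖) ^ 2)
          = (fun y => ENNReal.ofReal (t ^ k * (g y * (t⁻¹ * ‖y‖)) ^ 2)) (t • x) := by
        intro x
        simp only [norm_smul, Real.norm_of_nonneg ht0.le, inv_mul_cancel_left₀ ht0.ne']
      simp only [e]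
      refine (setLIntegral_comp_smul_le μ hS hSR hstar
        (fun y => ENNReal.ofReal (t ^ k * (g y * (t⁻¹ * ‖y‖)) ^ 2)) ht0 ht.2).trans ?_
      rw [← lintegral_const_mul' _ _ ENNReal.ofReal_ne_top,
        ← lintegral_indicator (hS.inter measurableSet_closedBall), ← lintegral_indicator hS]
      refine lintegral_mono fun y => ?_
      by_cases hy : y ∈ S ∩ closedBall 0 (t * R)
      swap
      · simp [indicator_of_notMem hy]
      have hy2 : t ∈ {t : ℝ | ‖y‖ ≤ t * R} := by simpa using hy.2
      rw [indicator_of_mem hy, indicator_of_mem hy.1, indicator_of_mem hy2,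
        ← ENNReal.ofReal_mul (by positivity), ← ENNReal.ofReal_mul (by positivity), hk]
      refine ENNReal.ofReal_le_ofReal (le_of_eq ?_)
      field_simp
      ring
    _ = ∫⁻ y in S, (∫⁻ t in Ioc a 1, {t : ℝ | ‖y‖ ≤ t * R}.indicator
          (fun t => ENNReal.ofReal ((t ^ 3)⁻¹ * ‖y‖ ^ 2)) t) * ENNReal.ofReal (g y ^ 2) ∂μ := by
      rw [lintegral_lintegral_swap hmeas.aemeasurable]
      refine lintegral_congr fun y => ?_
      rw [lintegral_mul_const' _ _ ENNReal.ofReal_ne_top]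
    _ ≤ ∫⁻ y in S, ENNReal.ofReal (R ^ 2 / 2) * ENNReal.ofReal (g y ^ 2) ∂μ := by
      refine lintegral_mono fun y => ?_
      gcongr
      exact lintegral_inv_cube_le (norm_nonneg y) hR _
    _ = _ := lintegral_const_mul' _ _ ENNReal.ofReal_ne_top

theorem setIntegral_sq_le_of_starShaped {S : Set E} (hS : MeasurableSet S) {R : ℝ} (hR : 0 < R)
    (hSR : S ⊆ closedBall 0 R) (hstar : ∀ x ∈ S, ∀ t : ℝ, 0 < t → t ≤ 1 → t • x ∈ S)
    {k : ℕ} (hk : Module.finrank ℝ E = k + 1) {v : E → ℝ} (hv : ContDiff ℝ 1 v) {a : ℝ}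
    (ha : 0 < a) (ha1 : a < 1) :
    ∫ x in S, v x ^ 2 ∂μ ≤
      2 * (a ^ (k + 1))⁻¹ * ∫ x in S ∩ closedBall 0 (a * R), v x ^ 2 ∂μ
        + R ^ 2 * (∫ t in a..1, (t ^ k)⁻¹) * ∫ x in S, ‖fderiv ℝ v x‖ ^ 2 ∂μ := by
  have hDv : Continuous (fderiv ℝ v) := hv.continuous_fderiv one_ne_zero
  have hvc : Continuous v := hv.continuous
  have hint : ∀ f : E → ℝ, Continuous f → IntegrableOn f S μ := fun f hf =>
    (hf.continuousOn.integrableOn_compact (isCompact_closedBall 0 R)).mono_set hSR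
  set L := ∫ t in a..1, (t ^ k)⁻¹
  have hL : 0 ≤ L := intervalIntegral.integral_nonneg ha1.le
    fun t ht => inv_nonneg.2 (pow_nonneg (ha.le.trans ht.1) k)
  have conv : ∀ (f : E → ℝ) (T : Set E), Continuous f → T ⊆ S →
      ∫⁻ x in T, ENNReal.ofReal (f x ^ 2) ∂μ = ENNReal.ofReal (∫ x in T, f x ^ 2 ∂μ) :=
    fun f T hf hT => (ofReal_integral_eq_lintegral_ofReal
      ((hint _ (hf.pow 2)).mono_set hT) (ae_of_all _ fun x => sq_nonneg (f x))).symm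
  have ray : ∀ x, ENNReal.ofReal (v x ^ 2) ≤ ENNReal.ofReal 2 * ENNReal.ofReal (v (a • x) ^ 2)
      + ENNReal.ofReal (2 * L) *
        ∫⁻ t in Ioc a 1, ENNReal.ofReal (t ^ k * (‖fderiv ℝ v (t • x)‖ * ‖x‖) ^ 2) := by
    intro x
    have hc : Continuous fun t : ℝ => t ^ k * (‖fderiv ℝ v (t • x)‖ * ‖x‖) ^ 2 := by fun_prop
    have hnn : ∀ t ∈ Ioc a 1, 0 ≤ t ^ k * (‖fderiv ℝ v (t • x)‖ * ‖x‖) ^ 2 := fun t ht => by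
      have := ha.trans ht.1
      positivity
    rw [← ofReal_integral_eq_lintegral_ofReal (hc.integrableOn_Ioc)
      ((ae_restrict_mem measurableSet_Ioc).mono hnn),
      ← ENNReal.ofReal_mul (by norm_num), ← ENNReal.ofReal_mul (by positivity),
      ← ENNReal.ofReal_add (by positivity)
        (mul_nonneg (by positivity) (setIntegral_nonneg measurableSet_Ioc hnn)),
      ← intervalIntegral.integral_of_le ha1.le, mul_assoc]
    exact ENNReal.ofReal_le_ofReal (sq_le_sq_smul_add_integral_ray hv k ha ha1 x)
  have main := lintegral_mono (μ := μ.restrict S) ray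
  rw [lintegral_add_left (by fun_prop), lintegral_const_mul' _ _ ENNReal.ofReal_ne_top,
    lintegral_const_mul' _ _ ENNReal.ofReal_ne_top] at main
  have h1 := setLIntegral_comp_smul_le μ hS hSR hstar
    (fun y => ENNReal.ofReal (v y ^ 2)) ha ha1.le
  have h2 := setLIntegral_ray_le μ hS hR hSR hstar hk hDv.norm ha
  rw [conv v _ hvc inter_subset_left, hk, ← ENNReal.ofReal_mul (by positivity)] at h1
  rw [conv _ _ hDv.norm subset_rfl, ← ENNReal.ofReal_mul (by positivity)] at h2
  rw [conv v _ hvc subset_rfl] at main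
  have fin := main.trans (add_le_add (mul_le_mul_right h1 _) (mul_le_mul_right h2 _))
  have n1 : 0 ≤ ∫ x in S ∩ closedBall 0 (a * R), v x ^ 2 ∂μ :=
    integral_nonneg fun x => sq_nonneg _
  have n2 : 0 ≤ ∫ x in S, ‖fderiv ℝ v x‖ ^ 2 ∂μ := integral_nonneg fun x => sq_nonneg _
  rw [← ENNReal.ofReal_mul (by positivity), ← ENNReal.ofReal_mul (by positivity),
    ← ENNReal.ofReal_add (by positivity) (by positivity),
    ENNReal.ofReal_le_ofReal_iff (by positivity)] at fin
  refine fin.trans (le_of_eq ?_)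
  ring

end StarShaped

theorem integral_inv_pow_le {k : ℕ} (hk : 2 ≤ k) {a : ℝ} (ha : 0 < a) (ha1 : a < 1) :
    ∫ t in a..1, (t ^ k)⁻¹ ≤ (a ^ (k - 1))⁻¹ := by
  obtain ⟨m, rfl⟩ := Nat.exists_eq_add_of_le hk
  have e : ∀ t : ℝ, (t ^ (2 + m))⁻¹ = t ^ (-(2 + m : ℤ)) := fun t => by
    rw [zpow_neg]; norm_cast
  have hz : (0 : ℝ) ∉ uIcc a 1 := by
    rw [uIcc_of_le ha1.le]
    exact fun h => ha.not_ge h.1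
  simp_rw [e]
  rw [integral_zpow (Or.inr ⟨by omega, hz⟩)]
  have e2 : a ^ (-(2 + m : ℤ) + 1) = (a ^ (2 + m - 1))⁻¹ := by
    rw [show -(2 + m : ℤ) + 1 = -((2 + m - 1 : ℕ) : ℤ) by omega, zpow_neg, zpow_natCast]
  rw [e2, one_zpow, ← neg_div_neg_eq]
  push_cast
  rw [div_le_iff₀ (by have : (0:ℝ) ≤ m := m.cast_nonneg
                      linarith)]
  have hp : 0 < (a ^ (2 + m - 1))⁻¹ := by positivity
  have : (0:ℝ) ≤ m := m.cast_nonneg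
  nlinarith [mul_nonneg hp.le this]

theorem setIntegral_sq_le_of_convex {E : Type*} [NormedAddCommGroup E] [NormedSpace ℝ E]
    [FiniteDimensional ℝ E] [MeasurableSpace E] [BorelSpace E] (μ : Measure E)
    [μ.IsAddHaarMeasure] {Γ : Set E} (hΓ : MeasurableSet Γ) (hconv : Convex ℝ Γ) {z : E}
    (hz : z ∈ Γ) {R : ℝ} (hR : 0 < R) (hΓR : Γ ⊆ closedBall z R) {k : ℕ}
    (hk : Module.finrank ℝ E = k + 1) {u : E → ℝ} (hu : ContDiff ℝ 1 u) {a : ℝ}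
    (ha : 0 < a) (ha1 : a < 1) :
    ∫ x in Γ, u x ^ 2 ∂μ ≤
      2 * (a ^ (k + 1))⁻¹ * ∫ x in Γ ∩ closedBall z (a * R), u x ^ 2 ∂μ
        + R ^ 2 * (∫ t in a..1, (t ^ k)⁻¹) * ∫ x in Γ, ‖fderiv ℝ u x‖ ^ 2 ∂μ := by
  have hpre : ∀ (f : E → ℝ) (T : Set E),
      ∫ x in (z + ·) ⁻¹' T, f (z + x) ∂μ = ∫ x in T, f x ∂μ := fun f T =>
    (measurePreserving_add_left μ z).setIntegral_preimage_emb
      (measurableEmbedding_addLeft z) f T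
  have hball : ∀ ρ : ℝ, (z + ·) ⁻¹' closedBall z ρ = closedBall (0 : E) ρ := fun ρ => by
    ext x
    simp [mem_closedBall, dist_eq_norm]
  have key := setIntegral_sq_le_of_starShaped μ (S := (z + ·) ⁻¹' Γ)
    (hΓ.preimage (measurable_const_add z)) hR
    (by rw [← hball]; exact preimage_mono hΓR)
    (fun x hx t ht ht1 => by
      have := hconv.add_smul_sub_mem hz hx ⟨ht.le, ht1⟩
      simpa using this)
    hk (v := fun x => u (z + x)) (hu.comp (contDiff_const.add contDiff_id)) ha ha1
  simp only [fderiv_comp_add_left] at key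
  rw [← hball, ← preimage_inter] at key
  simpa only [hpre (fun x => u x ^ 2), hpre (fun x => ‖fderiv ℝ u x‖ ^ 2)] using key

theorem one_le_abs_log {d : ℝ} (hd : 0 < d) (hd4 : d ≤ 1 / 4) : 1 ≤ |Real.log d| := by
  have h : Real.log d ≤ -1 := by
    rw [Real.log_le_iff_le_exp hd, Real.exp_neg]
    refine hd4.trans ?_
    rw [one_div]
    exact inv_anti₀ (Real.exp_pos 1) (by linarith [Real.exp_one_lt_three])
  rw [abs_of_nonpos (by linarith)]
  linarith

theorem integral_inv_le_mul_abs_log {a d M : ℝ} (ha : 0 < a) (hd : 0 < d) (hd4 : d ≤ 1 / 4)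
    (hM : 0 < M) (h : d ≤ M * a) :
    ∫ t in a..1, t⁻¹ ≤ (1 + |Real.log M|) * |Real.log d| := by
  rw [integral_inv_of_pos ha one_pos, one_div, Real.log_inv]
  have h1 : Real.log d ≤ Real.log M + Real.log a := by
    rw [← Real.log_mul hM.ne' ha.ne']
    exact Real.log_le_log hd h
  have h2 := one_le_abs_log hd hd4
  nlinarith [neg_le_abs (Real.log d), le_abs_self (Real.log M), abs_nonneg (Real.log M)]

theorem sq_mul_integral_inv_pow_le {k : ℕ} (hk : 1 ≤ k) {Ctil Csec Cinn d r : ℝ}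
    (hCtil : 0 < Ctil) (hCsec : 0 < Csec) (hCinn : 0 < Cinn) (hd : 0 < d) (hr : 0 < r)
    (hd4 : d ≤ 1 / 4) (hr2 : Csec * r ≤ 1 / 2) (ha1 : Cinn * d / (Ctil * r) < 1) :
    (Ctil * r) ^ 2 * ∫ t in (Cinn * d / (Ctil * r))..1, (t ^ k)⁻¹ ≤
      (Ctil ^ 2 * ((Ctil / Cinn) ^ (k - 1) + (1 + |Real.log (Ctil / (2 * Csec * Cinn))|))) *
        (r ^ (k + 1) * (d ^ 2 / d ^ (k + 1)) * (if k + 1 = 2 then |Real.log d| else 1)) := by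
  have ha : 0 < Cinn * d / (Ctil * r) := by positivity
  obtain rfl | hk2 := hk.eq_or_lt
  · have hle : d ≤ Ctil / (2 * Csec * Cinn) * (Cinn * d / (Ctil * r)) := by
      have e : Ctil / (2 * Csec * Cinn) * (Cinn * d / (Ctil * r)) = d / (2 * (Csec * r)) := by
        field_simp
      rw [e, le_div_iff₀ (by positivity)]
      nlinarith
    have h := integral_inv_le_mul_abs_log ha hd hd4 (by positivity) hle
    simp only [pow_one, Nat.reduceAdd, if_true, Nat.sub_self, pow_zero]
    calc
      _ ≤ (Ctil * r) ^ 2 * ((1 + |Real.log (Ctil / (2 * Csec * Cinn))|) * |Real.log d|) := by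
        gcongr
      _ ≤ (Ctil * r) ^ 2 *
          ((1 + (1 + |Real.log (Ctil / (2 * Csec * Cinn))|)) * |Real.log d|) := by
        gcongr
        linarith
      _ = _ := by
        rw [div_self (by positivity)]
        ring
  · have h := integral_inv_pow_le hk2 ha ha1
    rw [if_neg (by omega)]
    calc
      _ ≤ (Ctil * r) ^ 2 * ((Cinn * d / (Ctil * r)) ^ (k - 1))⁻¹ := by gcongr
      _ = (Ctil ^ 2 * (Ctil / Cinn) ^ (k - 1)) * (r ^ (k + 1) * (d ^ 2 / d ^ (k + 1)) * 1) := by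
        obtain ⟨m, rfl⟩ := Nat.exists_eq_add_of_le' hk
        simp only [Nat.add_sub_cancel, div_pow, mul_pow]
        field_simp
        ring
      _ ≤ _ := by
        gcongr
        have := abs_nonneg (Real.log (Ctil / (2 * Csec * Cinn)))
        linarith

theorem two_mul_le_diam_of_closedBall_subset {E : Type*} [NormedAddCommGroup E]
    [NormedSpace ℝ E] [Nontrivial E] {z : E} {ρ : ℝ} (hρ : 0 ≤ ρ) {s : Set E}
    (hs : Bornology.IsBounded s) (h : closedBall z ρ ⊆ s) : 2 * ρ ≤ diam s := by
  obtain ⟨e, he⟩ := exists_norm_eq E hρ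
  have h1 : z + e ∈ s := h (by simp [mem_closedBall, he])
  have h2 : z - e ∈ s := h (by simp [mem_closedBall, he])
  have := dist_le_diam_of_mem hs h1 h2
  rwa [dist_eq_norm, add_sub_sub_cancel, ← two_smul ℝ e, norm_smul, he, Real.norm_two] at this

theorem norm_gradient {F : Type*} [NormedAddCommGroup F] [InnerProductSpace ℝ F]
    [CompleteSpace F] (f : F → ℝ) (x : F) : ‖gradient f x‖ = ‖fderiv ℝ f x‖ :=
  (InnerProductSpace.toDual ℝ F).symm.norm_map _

/-- Lemma 3.4 of the paper (cell estimate by the hole boundary): for `n ≥ 2` and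
`C̃, C_sec, C_inn, C_R > 0` there is `C > 0` depending only on these constants and `n`
such that, whenever `0 < 2d ≤ C_sec r ≤ 1/2`, `Γ` is a bounded convex open set with
`B(x₀, C_sec r) ⊆ Γ` and `diam Γ ≤ C̃ r`, and `D` is an open set with
`closedBall(z, C_inn d) ⊆ D ⊆ closedBall(x₀, d)` satisfying the scaled Robin–Poincaré
inequality with constant `C_R`, every `C¹` function `u` satisfies
`∫_Γ u² ≤ C (rⁿ d^{1-n} ∫_{∂D} u² dH^{n-1} + rⁿ d^{2-n} ζ_d ∫_Γ ‖∇u‖²)`. -/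
theorem cell_estimate (n : ℕ) (hn : 2 ≤ n) (Ctil Csec Cinn CR : ℝ)
    (hCtil : 0 < Ctil) (hCsec : 0 < Csec) (hCinn : 0 < Cinn) (hCR : 0 < CR) :
    ∃ C > (0 : ℝ), ∀ (d r : ℝ) (x₀ z : EuclideanSpace ℝ (Fin n))
      (Γ D : Set (EuclideanSpace ℝ (Fin n))),
      0 < d → 0 < r → 2 * d ≤ Csec * r → Csec * r ≤ 1 / 2 →
      IsOpen Γ → Convex ℝ Γ → Bornology.IsBounded Γ →
      ball x₀ (Csec * r) ⊆ Γ → diam Γ ≤ Ctil * r →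
      IsOpen D → closedBall z (Cinn * d) ⊆ D → D ⊆ closedBall x₀ d →
      (∀ v : EuclideanSpace ℝ (Fin n) → ℝ, ContDiff ℝ 1 v →
        (∫ x in D, (v x) ^ 2) ≤
          CR * (d * (∫ x in frontier D, (v x) ^ 2 ∂(μH[(n : ℝ) - 1]))
            + d ^ 2 * (∫ x in D, ‖gradient v x‖ ^ 2))) →
      ∀ u : EuclideanSpace ℝ (Fin n) → ℝ, ContDiff ℝ 1 u →
        (∫ x in Γ, (u x) ^ 2) ≤
          C * (r ^ n * d ^ ((1 : ℝ) - n)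
                * (∫ x in frontier D, (u x) ^ 2 ∂(μH[(n : ℝ) - 1]))
            + r ^ n * d ^ ((2 : ℝ) - n) * (if n = 2 then |Real.log d| else 1)
                * (∫ x in Γ, ‖gradient u x‖ ^ 2)) := by
  obtain ⟨k, rfl⟩ : ∃ k, n = k + 1 := ⟨n - 1, by omega⟩
  have hfin : Module.finrank ℝ (EuclideanSpace ℝ (Fin (k + 1))) = k + 1 := by simp
  set C₁ := 2 * (Ctil / Cinn) ^ (k + 1) * CR with hC₁
  set C₂ := Ctil ^ 2 * ((Ctil / Cinn) ^ (k - 1) + (1 + |Real.log (Ctil / (2 * Csec * Cinn))|))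
  have hC₁0 : 0 < C₁ := by positivity
  have hC₂0 : 0 < C₂ := by positivity
  refine ⟨C₁ + C₂, by positivity, ?_⟩
  intro d r x₀ z Γ D hd hr hdr hr2 hΓo hΓc hΓb hxΓ hdiam hDo hzD hDx hRP u hu
  have hd4 : d ≤ 1 / 4 := by linarith
  have hDΓ : D ⊆ Γ := hDx.trans ((closedBall_subset_ball (by linarith)).trans hxΓ)
  have hzΓ : z ∈ Γ := hDΓ (hzD (mem_closedBall_self (by positivity)))
  have hρ := two_mul_le_diam_of_closedBall_subset (by positivity) hΓb (hzD.trans hDΓ)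
  have ha : 0 < Cinn * d / (Ctil * r) := by positivity
  have ha1 : Cinn * d / (Ctil * r) < 1 := by
    rw [div_lt_one (by positivity)]
    nlinarith [mul_pos hCinn hd]
  have hΓR : Γ ⊆ closedBall z (Ctil * r) := fun x hx =>
    (dist_le_diam_of_mem hΓb hx hzΓ).trans hdiam
  have main := setIntegral_sq_le_of_convex volume hΓo.measurableSet hΓc hzΓ (by positivity)
    hΓR hfin hu ha ha1
  have hW := sq_mul_integral_inv_pow_le (k := k) (by omega) hCtil hCsec hCinn hd hr hd4 hr2 ha1
  have hRPu := hRP u hu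
  simp only [norm_gradient] at hRPu ⊢
  have hint : ∀ f : EuclideanSpace ℝ (Fin (k + 1)) → ℝ, Continuous f → IntegrableOn f Γ :=
    fun f hf => (hf.continuousOn.integrableOn_compact (isCompact_closedBall z _)).mono_set hΓR
  have hmono : ∀ f : EuclideanSpace ℝ (Fin (k + 1)) → ℝ, Continuous f →
      ∀ S T : Set (EuclideanSpace ℝ (Fin (k + 1))), S ⊆ T → T ⊆ Γ →
      ∫ x in S, f x ^ 2 ≤ ∫ x in T, f x ^ 2 := fun f hf S T hST hT =>
    setIntegral_mono_set ((hint _ (hf.pow 2)).mono_set hT)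
      (ae_of_all _ fun x => sq_nonneg (f x)) hST.eventuallyLE
  have hballD := hmono u hu.continuous (Γ ∩ closedBall z (Cinn * d)) D
    (inter_subset_right.trans hzD) hDΓ
  have hgradD := hmono _ (hu.continuous_fderiv one_ne_zero).norm D Γ hDΓ subset_rfl
  rw [div_mul_cancel₀ _ (by positivity)] at main
  have hpow1 : d ^ ((1 : ℝ) - (k + 1 : ℕ)) = d / d ^ (k + 1) := by
    rw [Real.rpow_sub hd, Real.rpow_one, Real.rpow_natCast]
  have hpow2 : d ^ ((2 : ℝ) - (k + 1 : ℕ)) = d ^ 2 / d ^ (k + 1) := by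
    rw [Real.rpow_sub hd, Real.rpow_two, Real.rpow_natCast]
  rw [hpow1, hpow2]
  have hζ : 1 ≤ if k + 1 = 2 then |Real.log d| else 1 := by
    split_ifs
    exacts [one_le_abs_log hd hd4, le_rfl]
  set ζ := if k + 1 = 2 then |Real.log d| else 1
  set A := ∫ x in frontier D, u x ^ 2 ∂(μH[((k + 1 : ℕ) : ℝ) - 1])
  set G := ∫ x in Γ, ‖fderiv ℝ u x‖ ^ 2
  have hA : 0 ≤ A := integral_nonneg fun x => sq_nonneg _
  have hG : 0 ≤ G := integral_nonneg fun x => sq_nonneg _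
  calc
    _ ≤ 2 * ((Cinn * d / (Ctil * r)) ^ (k + 1))⁻¹ * (CR * (d * A + d ^ 2 * (ζ * G)))
        + C₂ * (r ^ (k + 1) * (d ^ 2 / d ^ (k + 1)) * ζ) * G := by
      refine main.trans (add_le_add ?_ (mul_le_mul_of_nonneg_right hW hG))
      gcongr
      refine hballD.trans (hRPu.trans ?_)
      gcongr
      exact hgradD.trans (le_mul_of_one_le_left hG hζ)
    _ = C₁ * (r ^ (k + 1) * (d / d ^ (k + 1)) * A + r ^ (k + 1) * (d ^ 2 / d ^ (k + 1)) * ζ * G)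
        + C₂ * (r ^ (k + 1) * (d ^ 2 / d ^ (k + 1)) * ζ * G) := by
      rw [hC₁]
      simp only [div_pow, mul_pow]
      field_simp
    _ ≤ _ := by
      have : 0 ≤ C₂ * (r ^ (k + 1) * (d / d ^ (k + 1)) * A) := by positivity
      linarith
end

section
/- For β ∈ (0, π/2], define the open sector T_β := {(ρ·cos θ, ρ·sin θ) ∈ ℝ² : 1/2 < ρ < 1, −β < θ < β}, the set 𝐃_β := (B(0,1) ∖ closedBall(0,1/2)) ∖ closure(T_β), and G_β := B(0,2) ∖ closure(𝐃_β). Then for every δ > 0 there exist β ∈ (0, π/2] and a Lipschitz function U : ℝ² → ℝ such that ∫_{G_β} U dx = 0, ∫_{G_β} U² dx > 0, and ∫_{G_β} ‖∇U‖² dx ≤ δ·∫_{G_β} U² dx, where ∇U denotes the (almost everywhere defined) gradient of U. -/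
open MeasureTheory Metric Set

/-- The open sector `T_β = {(ρ cos θ, ρ sin θ) : 1/2 < ρ < 1, -β < θ < β}` in `ℝ²`. -/
def sectorT (β : ℝ) : Set (EuclideanSpace ℝ (Fin 2)) :=
  {x | ∃ ρ θ : ℝ, 1 / 2 < ρ ∧ ρ < 1 ∧ -β < θ ∧ θ < β ∧
        x 0 = ρ * Real.cos θ ∧ x 1 = ρ * Real.sin θ}

/-- The slit annular hole `𝐃_β = (B(0,1) ∖ closedBall(0,1/2)) ∖ closure(T_β)`. -/
def holeD (β : ℝ) : Set (EuclideanSpace ℝ (Fin 2)) :=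
  (ball (0 : EuclideanSpace ℝ (Fin 2)) 1 \ closedBall (0 : EuclideanSpace ℝ (Fin 2)) (1 / 2))
    \ closure (sectorT β)

/-- The punctured ball `G_β = B(0,2) ∖ closure(𝐃_β)`. -/
def Gset (β : ℝ) : Set (EuclideanSpace ℝ (Fin 2)) :=
  ball (0 : EuclideanSpace ℝ (Fin 2)) 2 \ closure (holeD β)

lemma holeD_subset (β : ℝ) :
    closure (holeD β) ⊆ {x : EuclideanSpace ℝ (Fin 2) | 1 / 2 ≤ ‖x‖ ∧ ‖x‖ ≤ 1} := by
  refine closure_minimal ?_ ?_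
  · rintro x ⟨⟨h1, h2⟩, -⟩
    simp only [mem_ball, mem_closedBall, dist_zero_right, not_le] at h1 h2
    exact ⟨h2.le, h1.le⟩
  · exact (isClosed_le continuous_const continuous_norm).inter
      (isClosed_le continuous_norm continuous_const)

lemma mem_Gset_of_norm_lt_half {β : ℝ} {x : EuclideanSpace ℝ (Fin 2)} (hx : ‖x‖ < 1 / 2) :
    x ∈ Gset β := by
  refine ⟨by rw [mem_ball_zero_iff]; linarith, fun h => ?_⟩
  linarith [(holeD_subset β h).1]

lemma mem_Gset_of_one_lt_norm {β : ℝ} {x : EuclideanSpace ℝ (Fin 2)} (h1 : 1 < ‖x‖)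
    (h2 : ‖x‖ < 2) : x ∈ Gset β := by
  refine ⟨by rwa [mem_ball_zero_iff], fun h => ?_⟩
  linarith [(holeD_subset β h).2]

lemma measurableSet_Gset (β : ℝ) : MeasurableSet (Gset β) :=
  measurableSet_ball.diff isClosed_closure.measurableSet

/-- The rectangle `[-1, 1] × [-β, β]`, which contains the sector `T_β`. -/
def rectangle (β : ℝ) : Set (EuclideanSpace ℝ (Fin 2)) :=
  {x | |x 0| ≤ 1 ∧ |x 1| ≤ β}

lemma isClosed_rectangle (β : ℝ) : IsClosed (rectangle β) :=
  have h (i : Fin 2) (r : ℝ) : IsClosed {x : EuclideanSpace ℝ (Fin 2) | |x i| ≤ r} :=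
    isClosed_le (by fun_prop) continuous_const
  (h 0 1).inter (h 1 β)

lemma closure_sectorT_subset (β : ℝ) : closure (sectorT β) ⊆ rectangle β := by
  refine closure_minimal ?_ (isClosed_rectangle β)
  rintro x ⟨ρ, θ, h1, h2, h3, h4, h5, h6⟩
  have hρ : |ρ| ≤ 1 := abs_le.2 ⟨by linarith, h2.le⟩
  refine ⟨?_, ?_⟩
  · rw [h5, abs_mul]
    exact mul_le_one₀ hρ (abs_nonneg _) (Real.abs_cos_le_one θ)
  · rw [h6, abs_mul]
    calc |ρ| * |Real.sin θ| ≤ 1 * |θ| :=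
          mul_le_mul hρ Real.abs_sin_le_abs (abs_nonneg _) zero_le_one
      _ ≤ β := by rw [one_mul]; exact abs_le.2 ⟨h3.le, h4.le⟩

lemma volume_rectangle (β : ℝ) :
    volume (rectangle β) = ENNReal.ofReal 2 * ENNReal.ofReal (2 * β) := by
  have h : rectangle β = (WithLp.ofLp : EuclideanSpace ℝ (Fin 2) → Fin 2 → ℝ) ⁻¹'
      (Set.Icc ![-1, -β] ![1, β]) := by
    ext x
    simp [rectangle, abs_le, Pi.le_def, Fin.forall_fin_two]
    tauto
  rw [h, (PiLp.volume_preserving_ofLp (Fin 2)).measure_preimage measurableSet_Icc.nullMeasurableSet,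
    Real.volume_Icc_pi]
  simp only [Fin.prod_univ_two, Matrix.cons_val_zero, Matrix.cons_val_one]
  congr 2 <;> ring

/-- The radial cut-off function equal to `1` on `B(0, 1/2)` and to `0` outside `B(0, 1)`. -/
noncomputable def cutoff (x : EuclideanSpace ℝ (Fin 2)) : ℝ := max 0 (min 1 (2 - 2 * ‖x‖))

lemma cutoff_eq_one {x : EuclideanSpace ℝ (Fin 2)} (hx : ‖x‖ ≤ 1 / 2) : cutoff x = 1 := by
  rw [cutoff, min_eq_left (by linarith), max_eq_right zero_le_one]

lemma cutoff_eq_zero {x : EuclideanSpace ℝ (Fin 2)} (hx : 1 ≤ ‖x‖) : cutoff x = 0 := by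
  rw [cutoff, max_eq_left ((min_le_right _ _).trans (by linarith))]

lemma lipschitzWith_cutoff : LipschitzWith 2 cutoff := by
  have h : LipschitzWith 2 fun x : EuclideanSpace ℝ (Fin 2) => 2 - 2 * ‖x‖ := by
    refine LipschitzWith.of_dist_le_mul fun x y => ?_
    rw [Real.dist_eq, show 2 - 2 * ‖x‖ - (2 - 2 * ‖y‖) = 2 * (‖y‖ - ‖x‖) by ring, abs_mul,
      dist_comm, dist_eq_norm]
    simpa using abs_norm_sub_norm_le y x
  exact (h.const_min 1).const_max 0

lemma lipschitzWith_cutoff_sub (c : ℝ) : LipschitzWith 2 fun x => cutoff x - c :=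
  LipschitzWith.of_dist_le_mul fun x y => by
    simpa only [dist_sub_right] using lipschitzWith_cutoff.dist_le_mul x y

lemma norm_gradient_cutoff_sub_le (c : ℝ) (x : EuclideanSpace ℝ (Fin 2)) :
    ‖gradient (fun x => cutoff x - c) x‖ ≤ 2 := by
  rw [gradient, LinearIsometryEquiv.norm_map]
  exact norm_fderiv_le_of_lipschitz ℝ (lipschitzWith_cutoff_sub c)

lemma gradient_eq_zero_of_eventuallyEq_const {f : EuclideanSpace ℝ (Fin 2) → ℝ} {a : ℝ}
    {x : EuclideanSpace ℝ (Fin 2)} (h : f =ᶠ[nhds x] fun _ => a) : gradient f x = 0 := by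
  rw [gradient, h.fderiv_eq]
  simp

lemma gradient_cutoff_sub_of_norm_lt_half (c : ℝ) {x : EuclideanSpace ℝ (Fin 2)}
    (hx : ‖x‖ < 1 / 2) : gradient (fun x => cutoff x - c) x = 0 := by
  refine gradient_eq_zero_of_eventuallyEq_const (a := 1 - c) ?_
  filter_upwards [(isOpen_lt continuous_norm continuous_const).mem_nhds hx] with y hy
  rw [cutoff_eq_one (le_of_lt hy)]

lemma gradient_cutoff_sub_of_one_lt_norm (c : ℝ) {x : EuclideanSpace ℝ (Fin 2)}
    (hx : 1 < ‖x‖) : gradient (fun x => cutoff x - c) x = 0 := by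
  refine gradient_eq_zero_of_eventuallyEq_const (a := 0 - c) ?_
  filter_upwards [(isOpen_lt continuous_const continuous_norm).mem_nhds hx] with y hy
  rw [cutoff_eq_zero (le_of_lt hy)]

lemma Continuous.integrableOn_Gset {f : EuclideanSpace ℝ (Fin 2) → ℝ} (hf : Continuous f)
    (β : ℝ) : IntegrableOn f (Gset β) :=
  (hf.continuousOn.integrableOn_compact (isCompact_closedBall 0 2)).mono_set
    (sdiff_subset.trans ball_subset_closedBall)

lemma volume_Gset_ne_top (β : ℝ) : volume (Gset β) ≠ ⊤ :=
  measure_ne_top_of_subset sdiff_subset measure_ball_lt_top.ne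

/-- The Dirichlet energy on `G_β` is carried by the thin sector. -/
lemma integral_gradient_cutoff_sub_le {β : ℝ} (hβ : 0 ≤ β) (c : ℝ) :
    (∫ x in Gset β, ‖gradient (fun x => cutoff x - c) x‖ ^ 2) ≤ 16 * β := by
  have hvol : volume.real (rectangle β) = 4 * β := by
    rw [Measure.real, volume_rectangle, ENNReal.toReal_mul, ENNReal.toReal_ofReal (by norm_num),
      ENNReal.toReal_ofReal (by linarith)]
    ring
  have hfin : volume (rectangle β) ≠ ⊤ := by
    rw [volume_rectangle]
    exact ENNReal.mul_ne_top ENNReal.ofReal_ne_top ENNReal.ofReal_ne_top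
  have hint : Integrable ((rectangle β).indicator fun _ => (4 : ℝ)) :=
    (integrable_indicator_iff (isClosed_rectangle β).measurableSet).2 (integrableOn_const hfin)
  calc (∫ x in Gset β, ‖gradient (fun x => cutoff x - c) x‖ ^ 2)
      ≤ ∫ x in Gset β, (rectangle β).indicator (fun _ => (4 : ℝ)) x := by
        refine integral_mono_of_nonneg (Filter.Eventually.of_forall fun x => by positivity)
          hint.integrableOn ?_
        have hs (r : ℝ) (hr : r ≠ 0) :
            ∀ᵐ x : EuclideanSpace ℝ (Fin 2) ∂volume.restrict (Gset β), ‖x‖ ≠ r := by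
          refine ae_restrict_of_ae ?_
          filter_upwards [measure_eq_zero_iff_ae_notMem.1
            (Measure.addHaar_sphere_of_ne_zero volume (0 : EuclideanSpace ℝ (Fin 2)) hr)] with x hx
          simpa using hx
        filter_upwards [hs (1 / 2) (by norm_num), hs 1 one_ne_zero,
          ae_restrict_mem (measurableSet_Gset β)] with x h1 h2 hx
        have hnn : 0 ≤ (rectangle β).indicator (fun _ => (4 : ℝ)) x :=
          indicator_nonneg (fun _ _ => by norm_num) x
        rcases lt_or_gt_of_ne h1 with h1 | h1
        · simpa [gradient_cutoff_sub_of_norm_lt_half c h1] using hnn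
        rcases lt_or_gt_of_ne h2 with h2 | h2
        · have hmem : x ∈ rectangle β := by
            by_contra hr
            refine hx.2 (subset_closure ⟨⟨?_, ?_⟩, fun h => hr (closure_sectorT_subset β h)⟩)
            · simpa using h2
            · simpa using h1
          rw [indicator_of_mem hmem]
          nlinarith [norm_gradient_cutoff_sub_le c x,
            norm_nonneg (gradient (fun x => cutoff x - c) x)]
        · simpa [gradient_cutoff_sub_of_one_lt_norm c h2] using hnn
    _ ≤ ∫ x, (rectangle β).indicator (fun _ => (4 : ℝ)) x :=
        setIntegral_le_integral hint
          (Filter.Eventually.of_forall (indicator_nonneg fun _ _ => by norm_num))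
    _ = 16 * β := by
        rw [integral_indicator (isClosed_rectangle β).measurableSet, setIntegral_const, hvol,
          smul_eq_mul]
        ring

/-- The function takes two values differing by `1` on two disjoint discs of radius `1/2`. -/
lemma le_integral_cutoff_sub_sq (β c : ℝ) :
    volume.real (ball (0 : EuclideanSpace ℝ (Fin 2)) (1 / 2)) / 2 ≤
      ∫ x in Gset β, (cutoff x - c) ^ 2 := by
  set p : EuclideanSpace ℝ (Fin 2) := EuclideanSpace.single 0 (3 / 2)
  have hp : ‖p‖ = 3 / 2 := by simp [p]
  set V := volume.real (ball (0 : EuclideanSpace ℝ (Fin 2)) (1 / 2))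
  have hV : volume.real (ball p (1 / 2)) = V := by
    simp only [V, Measure.real, Measure.addHaar_ball_center volume p]
  have hA : ∀ x ∈ ball (0 : EuclideanSpace ℝ (Fin 2)) (1 / 2), ‖x‖ < 1 / 2 := by simp
  have hB : ∀ x ∈ ball p (1 / 2), 1 < ‖x‖ ∧ ‖x‖ < 2 := by
    intro x hx
    rw [mem_ball, dist_eq_norm] at hx
    have h := abs_le.1 (abs_norm_sub_norm_le x p)
    constructor <;> linarith [h.1, h.2]
  have hdisj : Disjoint (ball (0 : EuclideanSpace ℝ (Fin 2)) (1 / 2)) (ball p (1 / 2)) :=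
    disjoint_left.2 fun x h1 h2 => by linarith [hA x h1, (hB x h2).1]
  have hAG : ball (0 : EuclideanSpace ℝ (Fin 2)) (1 / 2) ⊆ Gset β :=
    fun x hx => mem_Gset_of_norm_lt_half (hA x hx)
  have hBG : ball p (1 / 2) ⊆ Gset β := fun x hx => mem_Gset_of_one_lt_norm (hB x hx).1 (hB x hx).2
  have hint : IntegrableOn (fun x => (cutoff x - c) ^ 2) (Gset β) :=
    ((lipschitzWith_cutoff_sub c).continuous.pow 2).integrableOn_Gset β
  calc V / 2 ≤ V * (1 - c) ^ 2 + V * (0 - c) ^ 2 := by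
        have : 0 ≤ V := measureReal_nonneg
        nlinarith [mul_nonneg this (sq_nonneg (2 * c - 1))]
    _ = (∫ x in ball 0 (1 / 2), (cutoff x - c) ^ 2) + ∫ x in ball p (1 / 2), (cutoff x - c) ^ 2 := by
        rw [setIntegral_congr_fun (g := fun _ => (1 - c) ^ 2) measurableSet_ball
            fun x hx => by simp only [cutoff_eq_one (hA x hx).le],
          setIntegral_congr_fun (s := ball p (1 / 2)) (g := fun _ => (0 - c) ^ 2) measurableSet_ball
            fun x hx => by simp only [cutoff_eq_zero (hB x hx).1.le],
          setIntegral_const, setIntegral_const, hV, smul_eq_mul, smul_eq_mul]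
    _ = ∫ x in ball 0 (1 / 2) ∪ ball p (1 / 2), (cutoff x - c) ^ 2 :=
        (setIntegral_union hdisj measurableSet_ball (hint.mono_set hAG) (hint.mono_set hBG)).symm
    _ ≤ ∫ x in Gset β, (cutoff x - c) ^ 2 :=
        setIntegral_mono_set hint (Filter.Eventually.of_forall fun x => sq_nonneg _)
          (union_subset hAG hBG).eventuallyLE

/-- The paper's two-dimensional example: the first nonzero Neumann eigenvalue of
`G_β = B(0,2) ∖ closure(𝐃_β)` can be made arbitrarily small. For every `δ > 0` there are
`β ∈ (0, π/2]` and a Lipschitz function `U : ℝ² → ℝ` with `∫_{G_β} U = 0`,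
`∫_{G_β} U² > 0` and `∫_{G_β} ‖∇U‖² ≤ δ ∫_{G_β} U²`. -/
theorem neumann_eigenvalue_not_uniformly_bounded (δ : ℝ) (hδ : 0 < δ) :
    ∃ β ∈ Set.Ioc (0 : ℝ) (Real.pi / 2),
      ∃ (U : EuclideanSpace ℝ (Fin 2) → ℝ) (K : NNReal),
        LipschitzWith K U ∧
        (∫ x in Gset β, U x) = 0 ∧
        0 < (∫ x in Gset β, (U x) ^ 2) ∧
        (∫ x in Gset β, ‖gradient U x‖ ^ 2) ≤ δ * (∫ x in Gset β, (U x) ^ 2) := by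
  set V := volume.real (ball (0 : EuclideanSpace ℝ (Fin 2)) (1 / 2)) with hVdef
  have hV : 0 < V := by
    rw [hVdef, Measure.real]
    exact ENNReal.toReal_pos (measure_ball_pos volume _ (by norm_num)).ne' measure_ball_lt_top.ne
  set β := min (Real.pi / 2) (δ * V / 32)
  have hβ : 0 < β := lt_min (by positivity) (by positivity)
  have hβδ : β ≤ δ * V / 32 := min_le_right _ _
  set c := ⨍ x in Gset β, cutoff x
  have hsq := le_integral_cutoff_sub_sq β c
  refine ⟨β, ⟨hβ, min_le_left _ _⟩, fun x => cutoff x - c, 2, lipschitzWith_cutoff_sub c, ?_,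
    lt_of_lt_of_le (half_pos hV) hsq, ?_⟩
  · exact setAverage_sub_setAverage (volume_Gset_ne_top β) cutoff
  · calc (∫ x in Gset β, ‖gradient (fun x => cutoff x - c) x‖ ^ 2) ≤ 16 * β :=
          integral_gradient_cutoff_sub_le hβ.le c
      _ ≤ δ * (V / 2) := by linarith
      _ ≤ _ := mul_le_mul_of_nonneg_left hsq hδ.le
end
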